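/- Let α ∈ (g,1] and set x_n = T_α^n(α−1), y_n = T_α^n(1/α − 1). Let m ∈ ℕ be such that x_n ≤ 1/(α+1) and y_n ≤ 1/(α+1) for all 0 ≤ n < m, and suppose x_m > 1/(α+1) or y_m > 1/(α+1). Then the maps z ↦ T_z^m(z−1) and z ↦ T_z^m(1/z − 1) are continuous at z = α, and all the inequalities in the hypothesis are strict, i.e., x_n < 1/(α+1) and y_n < 1/(α+1) for all 0 ≤ n < m. -/

import Mathlib

open Set Filter MeasureTheory

/-- The Tanaka–Ito `α`-continued fraction map. -/
noncomputable def T (α x : ℝ) : ℝ := if x = 0 then 0 else 1 / x - (⌊1 / x + 1 - α⌋ : ℝ)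

/-- The small golden mean `g = (√5 - 1)/2`. -/
noncomputable def g : ℝ := (Real.sqrt 5 - 1) / 2

theorem T_of_ne_zero {α x : ℝ} (hx : x ≠ 0) :
    T α x = 1 / x - (⌊1 / x + 1 - α⌋ : ℝ) := if_neg hx

theorem T_zero (α : ℝ) : T α 0 = 0 := if_pos rfl

theorem T_mem_Ico {α x : ℝ} (hx : x ≠ 0) : T α x ∈ Ico (α - 1) α := by
  rw [T_of_ne_zero hx]
  have h₁ := Int.floor_le (1 / x + 1 - α)
  have h₂ := Int.lt_floor_add_one (1 / x + 1 - α)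
  constructor <;> linarith

theorem T_eq_of_mem_Ico {α x : ℝ} (hx : x ≠ 0) (d : ℤ) (h : 1 / x - d ∈ Ico (α - 1) α) :
    T α x = 1 / x - d := by
  have hd : ⌊1 / x + 1 - α⌋ = d := by
    rw [Int.floor_eq_iff]
    constructor <;> linarith [h.1, h.2]
  rw [T_of_ne_zero hx, hd]

/-- `T` depends on a nonzero `x` only through the class of `1 / x` modulo `1`. -/
theorem T_eq_of_one_div_eq_add_intCast {α x y : ℝ} (hx : x ≠ 0) (hy : y ≠ 0) (d : ℤ)
    (h : 1 / x = 1 / y + d) : T α x = T α y := by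
  have hf : 1 / y + d + 1 - α = 1 / y + 1 - α + d := by ring
  rw [T_of_ne_zero hx, T_of_ne_zero hy, h, hf, Int.floor_add_intCast]
  push_cast
  ring

theorem T_add_T_of_one_div_add_one_div {α x y : ℝ} (hα : α ∈ Ioc (1 / 2) 1)
    (hx : x ≠ 0) (hy : y ≠ 0) (d : ℤ) (h : 1 / x + 1 / y = d) :
    T α x + T α y = 0 ∨ T α x + T α y = 1 := by
  obtain ⟨hx₁, hx₂⟩ := T_mem_Ico (α := α) hx
  obtain ⟨hy₁, hy₂⟩ := T_mem_Ico (α := α) hy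
  obtain ⟨hα₁, hα₂⟩ := hα
  obtain ⟨k, hk⟩ : ∃ k : ℤ, T α x + T α y = k := by
    refine ⟨d - ⌊1 / x + 1 - α⌋ - ⌊1 / y + 1 - α⌋, ?_⟩
    rw [T_of_ne_zero hx, T_of_ne_zero hy]
    push_cast
    linarith
  have hk₁ : -1 < k := by
    have : (-1 : ℝ) < k := by linarith
    exact_mod_cast this
  have hk₂ : k < 2 := by
    have : (k : ℝ) < 2 := by linarith
    exact_mod_cast this
  rw [hk]
  obtain rfl | rfl : k = 0 ∨ k = 1 := by omega
  · simp
  · simp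

theorem golden_bounds {α : ℝ} (h : g < α) : 1 / 2 < α ∧ 1 < α + α ^ 2 := by
  have h₅ : (2 : ℝ) < √5 := Real.lt_sqrt_of_sq_lt (by norm_num)
  have hs : √5 ^ 2 = 5 := Real.sq_sqrt (by norm_num)
  rw [g] at h
  constructor
  · linarith
  · nlinarith

theorem T_eq_sub_one {α x : ℝ} (hα : g < α) (hx : x = 1 / (α + 1)) :
    T α x = α - 1 := by
  obtain ⟨h₁, -⟩ := golden_bounds hα
  have hx₀ : 0 < x := by rw [hx]; positivity
  have hx' : 1 / x = α + 1 := by rw [hx, one_div_one_div]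
  have := T_eq_of_mem_Ico (α := α) hx₀.ne' 2 (by
    rw [hx']
    push_cast
    constructor <;> linarith)
  rw [this, hx']
  push_cast
  ring

/-- The relation satisfied by the `T α`-orbits of `α - 1` and `1 / α - 1` as long as neither
exceeds `1 / (α + 1)`. -/
structure Linked (α x y : ℝ) : Prop where
  left_mem : x ∈ Ico (α - 1) α
  right_mem : y ∈ Ico (α - 1) α
  cases : x + y = 0 ∨ x + y = 1 ∨ (1 + x) * (1 + y) = 1

namespace Linked

variable {α x y : ℝ}

theorem symm (h : Linked α x y) : Linked α y x :=
  ⟨h.right_mem, h.left_mem, by simpa only [add_comm, mul_comm] using h.cases⟩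

theorem endpoints (hα : α ∈ Ioc g 1) : Linked α (α - 1) (1 / α - 1) := by
  obtain ⟨h₁, h₂⟩ := golden_bounds hα.1
  have hα₀ : 0 < α := by linarith
  have hinv : 1 ≤ 1 / α := by rw [le_div_iff₀ hα₀]; linarith [hα.2]
  have hinv' : 1 / α < α + 1 := by rw [div_lt_iff₀ hα₀]; nlinarith
  refine ⟨⟨le_rfl, by linarith⟩, ⟨by linarith [hα.2], by linarith⟩, .inr (.inr ?_)⟩
  field_simp
  ring

theorem left_lt (h : Linked α x y) (hα : g < α) (hxy : x + y ≠ 1) : x < 1 / (α + 1) := by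
  obtain ⟨h₁, h₂⟩ := golden_bounds hα
  obtain ⟨⟨hx, -⟩, ⟨hy, -⟩, h | h | h⟩ := h
  · rw [lt_div_iff₀ (by linarith)]
    nlinarith
  · exact absurd h hxy
  · have hxα : (1 + x) * α ≤ 1 := by nlinarith
    rw [lt_div_iff₀ (by linarith)]
    by_contra! hc
    nlinarith

theorem right_eq_zero (h : Linked α x y) (hα : α ≤ 1) (hx : x = 0) : y = 0 := by
  subst hx
  have := h.right_mem.2
  rcases h.cases with h | h | h <;> linarith

theorem step (h : Linked α x y) (hα : α ∈ Ioc g 1)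
    (hx : x ≤ 1 / (α + 1)) (hy : y ≤ 1 / (α + 1)) : Linked α (T α x) (T α y) := by
  obtain ⟨h₁, h₂⟩ := golden_bounds hα.1
  by_cases hx₀ : x = 0
  · obtain rfl : y = 0 := h.right_eq_zero hα.2 hx₀
    subst hx₀
    rw [T_zero]
    exact ⟨h.left_mem, h.right_mem, .inl (add_zero 0)⟩
  have hy₀ : y ≠ 0 := fun hy₀ => hx₀ (h.symm.right_eq_zero hα.2 hy₀)
  have hsum (d : ℤ) (hd : 1 / x + 1 / y = d) : Linked α (T α x) (T α y) := by
    refine ⟨T_mem_Ico hx₀, T_mem_Ico hy₀, ?_⟩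
    have := T_add_T_of_one_div_add_one_div ⟨h₁, hα.2⟩ hx₀ hy₀ d hd
    tauto
  rcases h.cases with h | h | h
  · refine hsum 0 ?_
    rw [div_add_div _ _ hx₀ hy₀]
    simp [add_comm y x, h]
  · have hT {u v : ℝ} (huv : u + v = 1) (hu : u ≤ 1 / (α + 1)) (hv : v ≤ 1 / (α + 1)) :
        T α u = 1 / u - 2 := by
      rw [le_div_iff₀ (by linarith)] at hu hv
      have hu₀ : 0 < u := by nlinarith
      refine mod_cast T_eq_of_mem_Ico hu₀.ne' 2 ⟨?_, ?_⟩
      · have : α + 1 ≤ 1 / u := by rw [le_div_iff₀ hu₀]; linarith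
        push_cast
        linarith
      · have : 1 / u < α + 2 := by rw [div_lt_iff₀ hu₀]; nlinarith
        push_cast
        linarith
    refine ⟨T_mem_Ico hx₀, T_mem_Ico hy₀, .inr (.inr ?_)⟩
    rw [hT h hx hy, hT (by linarith) hy hx]
    field_simp
    obtain rfl : y = 1 - x := by linarith
    ring
  · refine hsum (-1) ?_
    rw [div_add_div _ _ hx₀ hy₀, div_eq_iff (mul_ne_zero hx₀ hy₀)]
    push_cast
    linarith

theorem add_ne_one_of_left_eq (h : Linked α x y) (hα : α ≤ 1) (hx : x = α - 1) : x + y ≠ 1 := by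
  intro hxy
  linarith [h.right_mem.2]

theorem T_right_of_left_eq (h : Linked α x y) (hα : α ∈ Ioo g 1) (hx : x = α - 1) :
    T α y = T α (1 / α - 1) := by
  obtain ⟨h₁, -⟩ := golden_bounds hα.1
  have hα₁ : 1 - α ≠ 0 := by linarith [hα.2]
  have hα₀ : α ≠ 0 := by linarith
  have hα₂ : 1 / α - 1 ≠ 0 := by
    rw [div_sub_one hα₀]
    exact div_ne_zero hα₁ hα₀
  have hne := h.add_ne_one_of_left_eq hα.2.le hx
  rcases h.cases with h | h | h
  · obtain rfl : y = 1 - α := by linarith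
    refine T_eq_of_one_div_eq_add_intCast hα₁ hα₂ 1 ?_
    push_cast
    rw [div_sub_one hα₀]
    field_simp
    ring
  · exact absurd h hne
  · congr 1
    rw [hx] at h
    field_simp
    linarith

end Linked

theorem continuousAt_T {u : ℝ → ℝ} {α : ℝ} (hu : ContinuousAt u α) (h₀ : u α ≠ 0)
    (h₁ : T α (u α) ≠ α - 1) : ContinuousAt (fun z => T z (u z)) α := by
  set d := ⌊1 / u α + 1 - α⌋ with hd
  have hw : ContinuousAt (fun z => 1 / u z + 1 - z) α :=
    ((continuousAt_const.div hu h₀).add continuousAt_const).sub continuousAt_id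
  rw [T_of_ne_zero h₀, ← hd] at h₁
  have hlt : (d : ℝ) < 1 / u α + 1 - α :=
    lt_of_le_of_ne (Int.floor_le _) fun h => h₁ (by linarith)
  have hgt : 1 / u α + 1 - α < d + 1 := Int.lt_floor_add_one _
  have hev : (fun z => 1 / u z - (d : ℝ)) =ᶠ[nhds α] fun z => T z (u z) := by
    filter_upwards [hu.eventually_ne h₀, hw.eventually_const_lt hlt, hw.eventually_lt_const hgt]
      with z hz hz₁ hz₂
    rw [T_of_ne_zero hz, Int.floor_eq_iff.2 ⟨hz₁.le, hz₂⟩]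
  exact ((continuousAt_const.div hu h₀).sub continuousAt_const).congr hev

theorem continuousAt_iterate_T {f : ℝ → ℝ} {α : ℝ} (hf : ContinuousAt f α) (m : ℕ)
    (h₀ : ∀ n < m, (T α)^[n] (f α) ≠ 0) (h₁ : ∀ n < m, (T α)^[n + 1] (f α) ≠ α - 1) :
    ContinuousAt (fun z => (T z)^[m] (f z)) α := by
  induction m with
  | zero => exact hf
  | succ m ih =>
    simp only [Function.iterate_succ_apply'] at h₁ ⊢
    refine continuousAt_T (ih (fun n hn => h₀ n (by omega)) fun n hn => ?_) (h₀ m m.lt_succ_self)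
      (h₁ m m.lt_succ_self)
    rw [Function.iterate_succ_apply']
    exact h₁ n (by omega)

theorem stmt3 (α : ℝ) (hα : α ∈ Set.Ioc g 1) (m : ℕ)
    (h : ∀ n < m, (T α)^[n] (α - 1) ≤ 1 / (α + 1) ∧ (T α)^[n] (1 / α - 1) ≤ 1 / (α + 1))
    (hm : 1 / (α + 1) < (T α)^[m] (α - 1) ∨ 1 / (α + 1) < (T α)^[m] (1 / α - 1)) :
    ContinuousAt (fun z => (T z)^[m] (z - 1)) α ∧
    ContinuousAt (fun z => (T z)^[m] (1 / z - 1)) α ∧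
    (∀ n < m, (T α)^[n] (α - 1) < 1 / (α + 1) ∧ (T α)^[n] (1 / α - 1) < 1 / (α + 1)) := by
  obtain ⟨h₁, -⟩ := golden_bounds hα.1
  have hpos : 0 < 1 / (α + 1) := by positivity
  have hlink (n : ℕ) (hn : n ≤ m) :
      Linked α ((T α)^[n] (α - 1)) ((T α)^[n] (1 / α - 1)) := by
    induction n with
    | zero => exact Linked.endpoints hα
    | succ n ih =>
      rw [Function.iterate_succ_apply', Function.iterate_succ_apply']
      exact (ih (by omega)).step hα (h n hn).1 (h n hn).2
  have hne_zero (n : ℕ) (hn : n ≤ m) :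
      (T α)^[n] (α - 1) ≠ 0 ∧ (T α)^[n] (1 / α - 1) ≠ 0 := by
    obtain ⟨k, rfl⟩ := Nat.exists_eq_add_of_le' hn
    have hfix : (T α)^[k] 0 = 0 := Function.iterate_fixed (T_zero α) k
    rw [Function.iterate_add_apply, Function.iterate_add_apply] at hm
    have hl := hlink n hn
    by_contra hc
    have hx : (T α)^[n] (α - 1) = 0 ∧ (T α)^[n] (1 / α - 1) = 0 := by
      by_cases hx : (T α)^[n] (α - 1) = 0
      · exact ⟨hx, hl.right_eq_zero hα.2 hx⟩
      · have hy : (T α)^[n] (1 / α - 1) = 0 := by tauto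
        exact ⟨hl.symm.right_eq_zero hα.2 hy, hy⟩
    rw [hx.1, hx.2, hfix] at hm
    rcases hm with hm | hm <;> linarith
  have hα₁ : α < 1 := lt_of_le_of_ne hα.2 fun hα₁ =>
    (hne_zero 0 m.zero_le).1 (by rw [Function.iterate_zero_apply, hα₁, sub_self])
  have hadd (hc : (T α)^[m] (α - 1) + (T α)^[m] (1 / α - 1) ≠ 1) : False := by
    have hl := hlink m le_rfl
    rcases hm with hm | hm
    · exact hm.not_gt (hl.left_lt hα.1 hc)
    · exact hm.not_gt (hl.symm.left_lt hα.1 (by rwa [add_comm]))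
  have hne (n : ℕ) (hn : n < m) :
      (T α)^[n + 1] (α - 1) ≠ α - 1 ∧ (T α)^[n + 1] (1 / α - 1) ≠ α - 1 := by
    have hl := hlink (n + 1) hn
    obtain rfl | hlt := (Nat.succ_le_of_lt hn).eq_or_lt
    · exact ⟨fun hx => hadd (hl.add_ne_one_of_left_eq hα.2 hx), fun hy =>
        hadd (by rw [add_comm]; exact hl.symm.add_ne_one_of_left_eq hα.2 hy)⟩
    obtain ⟨k, rfl⟩ : ∃ k, m = k + 1 + (n + 1) := ⟨m - n - 2, by omega⟩
    obtain ⟨hk₁, hk₂⟩ := h (k + 1) (by omega)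
    rw [Function.iterate_add_apply _ (k + 1) (n + 1), Function.iterate_add_apply _ (k + 1) (n + 1),
      Function.iterate_succ_apply _ k, Function.iterate_succ_apply _ k] at hm
    rw [Function.iterate_succ_apply] at hk₁ hk₂
    constructor
    · intro hx
      rw [hl.T_right_of_left_eq ⟨hα.1, hα₁⟩ hx, hx] at hm
      rcases hm with hm | hm <;> linarith
    · intro hy
      rw [hl.symm.T_right_of_left_eq ⟨hα.1, hα₁⟩ hy, hy] at hm
      rcases hm with hm | hm <;> linarith
  refine ⟨?_, ?_, fun n hn => ⟨(h n hn).1.lt_of_ne fun hx => ?_, (h n hn).2.lt_of_ne fun hy => ?_⟩⟩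
  · exact continuousAt_iterate_T (f := fun z => z - 1) (by fun_prop) m
      (fun n hn => (hne_zero n hn.le).1) fun n hn => (hne n hn).1
  · exact continuousAt_iterate_T (f := fun z => 1 / z - 1)
      ((continuousAt_const.div continuousAt_id (by simp; linarith)).sub continuousAt_const) m
      (fun n hn => (hne_zero n hn.le).2) fun n hn => (hne n hn).2
  · refine (hne n hn).1 ?_
    rw [Function.iterate_succ_apply']
    exact T_eq_sub_one hα.1 hx
  · refine (hne n hn).2 ?_
    rw [Function.iterate_succ_apply']
    exact T_eq_sub_one hα.1 hy
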